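/- For every f ∈ C_0^∞(ℝ⁺), the Duhamel boundary forcing operator of order 0 satisfies the distributional identity i L⁰(∂_t f)(t,x) = i M δ₀(x) I_{−3/4} f(t) + ∂_x⁴ L⁰ f(t,x), where δ₀ is the Dirac delta at x = 0; equivalently, (i∂_t − ∂_x⁴) L⁰f(t,x) = i M δ₀(x) I_{−3/4} f(t) in the sense of distributions on ℝ² . -/

import Mathlib

open MeasureTheory Complex Filter Set

noncomputable section

/-- One-dimensional Fourier transform `φ̂(ξ) = ∫ e^{-iξx} φ(x) dx`. -/
def FT (f : ℝ → ℂ) (ξ : ℝ) : ℂ :=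
  ∫ x : ℝ, Complex.exp (-(Complex.I * ξ * x)) * f x

/-- The `Hˢ(ℝ)` Sobolev norm `‖(1+|ξ|²)^{s/2} φ̂‖_{L²}`. -/
def sobNorm (s : ℝ) (f : ℝ → ℂ) : ℝ :=
  (∫ ξ : ℝ, (1 + ξ ^ 2) ^ s * ‖FT f ξ‖ ^ 2) ^ ((1 : ℝ) / 2)

/-- Membership in `Hˢ(ℝ)`. -/
def MemHs (s : ℝ) (f : ℝ → ℂ) : Prop :=
  Integrable (fun ξ : ℝ => (1 + ξ ^ 2) ^ s * ‖FT f ξ‖ ^ 2)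

/-- Membership in `Hˢ(ℝ⁺)`: restriction of an `Hˢ(ℝ)` function to `(0,∞)`. -/
def MemHsHalf (s : ℝ) (f : ℝ → ℂ) : Prop :=
  ∃ F : ℝ → ℂ, MemHs s F ∧ ∀ x > 0, F x = f x

/-- The `Hˢ(ℝ⁺)` norm: infimum of the norms of all extensions. -/
def sobNormHalf (s : ℝ) (f : ℝ → ℂ) : ℝ :=
  sInf {c : ℝ | ∃ F : ℝ → ℂ, MemHs s F ∧ (∀ x > 0, F x = f x) ∧ c = sobNorm s F}

/-- Membership in `H₀ˢ(ℝ⁺)`: extension vanishing on `(-∞,0)`. -/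
def MemHsZero (s : ℝ) (f : ℝ → ℂ) : Prop :=
  ∃ F : ℝ → ℂ, MemHs s F ∧ (∀ x > 0, F x = f x) ∧ ∀ x < 0, F x = 0

/-- The `H₀ˢ(ℝ⁺)` norm. -/
def sobNormZero (s : ℝ) (f : ℝ → ℂ) : ℝ :=
  sInf {c : ℝ | ∃ F : ℝ → ℂ,
    MemHs s F ∧ (∀ x > 0, F x = f x) ∧ (∀ x < 0, F x = 0) ∧ c = sobNorm s F}

/-- Membership in `Hˢ(0,T)`. -/
def MemHsInterval (s T : ℝ) (f : ℝ → ℂ) : Prop :=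
  ∃ F : ℝ → ℂ, MemHs s F ∧ ∀ t ∈ Set.Ioo (0 : ℝ) T, F t = f t

/-- The `Hˢ(0,T)` norm. -/
def sobNormInterval (s T : ℝ) (f : ℝ → ℂ) : ℝ :=
  sInf {c : ℝ | ∃ F : ℝ → ℂ,
    MemHs s F ∧ (∀ t ∈ Set.Ioo (0 : ℝ) T, F t = f t) ∧ c = sobNorm s F}

/-- Space-time Fourier transform `f̃(τ,ξ)` of `f(t,x)`. -/
def FT2 (f : ℝ → ℝ → ℂ) (τ ξ : ℝ) : ℂ :=
  ∫ t : ℝ, ∫ x : ℝ, Complex.exp (-(Complex.I * (ξ * x + τ * t))) * f t x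

/-- Bourgain `X^{s,b}` norm associated with `i∂ₜu - ∂ₓ⁴u = 0`. -/
def XNorm (s b : ℝ) (f : ℝ → ℝ → ℂ) : ℝ :=
  (∫ τ : ℝ, ∫ ξ : ℝ,
    (1 + ξ ^ 2) ^ s * (1 + (τ + ξ ^ 4) ^ 2) ^ b * ‖FT2 f τ ξ‖ ^ 2) ^ ((1 : ℝ) / 2)

/-- Membership in the Bourgain space `X^{s,b}`. -/
def MemX (s b : ℝ) (f : ℝ → ℝ → ℂ) : Prop :=
  Integrable (fun p : ℝ × ℝ =>
    (1 + p.2 ^ 2) ^ s * (1 + (p.1 + p.2 ^ 4) ^ 2) ^ b * ‖FT2 f p.1 p.2‖ ^ 2)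

/-- Membership in the restricted space `X^{s,b}((0,T) × ℝ⁺)`. -/
def MemXRestricted (s b T : ℝ) (u : ℝ → ℝ → ℂ) : Prop :=
  ∃ U : ℝ → ℝ → ℂ, MemX s b U ∧ ∀ t ∈ Set.Ioo (0 : ℝ) T, ∀ x > (0 : ℝ), U t x = u t x

/-- The group `e^{it∂ₓ⁴}φ(x) = (1/2π) ∫ e^{ixξ} e^{-itξ⁴} φ̂(ξ) dξ`. -/
def linGroup (t : ℝ) (φ : ℝ → ℂ) (x : ℝ) : ℂ :=
  (1 / (2 * Real.pi)) * ∫ ξ : ℝ, Complex.exp (Complex.I * x * ξ) *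
    Complex.exp (-(Complex.I * t * ξ ^ 4)) * FT φ ξ

/-- Duhamel inhomogeneous solution operator `Dw(t,x) = -i∫₀ᵗ e^{i(t-t')∂ₓ⁴} w(t') dt'`. -/
def Duhamel (w : ℝ → ℝ → ℂ) (t x : ℝ) : ℂ :=
  -Complex.I * ∫ t' in (0 : ℝ)..t, linGroup (t - t') (w t') x

/-- A smooth cut-off `ψ` with `0 ≤ ψ ≤ 1`, `ψ ≡ 1` on `[0,1]`, `ψ ≡ 0` for `|t| ≥ 2`. -/
def IsCutoff (ψ : ℝ → ℝ) : Prop :=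
  ContDiff ℝ (⊤ : ℕ∞) ψ ∧ (∀ t, ψ t ∈ Set.Icc (0 : ℝ) 1) ∧
    (∀ t ∈ Set.Icc (0 : ℝ) 1, ψ t = 1) ∧ ∀ t : ℝ, 2 ≤ |t| → ψ t = 0

/-- `C₀^∞(ℝ⁺)`: smooth functions on `ℝ` with support contained in `[0,∞)`. -/
def SmoothSupp (f : ℝ → ℂ) : Prop :=
  ContDiff ℝ (⊤ : ℕ∞) f ∧ ∀ x < (0 : ℝ), f x = 0

/-- `C₀,c^∞(ℝ⁺)`: smooth functions with compact support contained in `(0,∞)`. -/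
def SmoothCpt (f : ℝ → ℂ) : Prop :=
  ContDiff ℝ (⊤ : ℕ∞) f ∧ HasCompactSupport f ∧ tsupport f ⊆ Set.Ioi 0

/-- The Riemann-Liouville operator `I_α`, extended to all `α ∈ ℂ` by
`t₊^{α-1}/Γ(α) = ∂ₜᵏ (t₊^{α+k-1}/Γ(α+k))`. -/
def RL (α : ℂ) (f : ℝ → ℂ) (t : ℝ) : ℂ :=
  if 0 < α.re then
    (1 / Complex.Gamma α) * ∫ s in (0 : ℝ)..t, ((t - s : ℝ) : ℂ) ^ (α - 1) * f s
  else
    (1 / Complex.Gamma (α + (⌈-α.re⌉₊ + 1 : ℕ))) *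
      ∫ s in (0 : ℝ)..t, ((t - s : ℝ) : ℂ) ^ (α + (⌈-α.re⌉₊ + 1 : ℕ) - 1) *
        iteratedDeriv (⌈-α.re⌉₊ + 1) f s

/-- The oscillatory integral `B(x) = (1/2π) ∫ e^{ixξ} e^{-iξ⁴} dξ`, as the regularized
limit with factors `e^{-ε|ξ|}` as `ε → 0⁺`. -/
def Bker (x : ℝ) : ℂ :=
  limUnder (nhdsWithin (0 : ℝ) (Set.Ioi 0)) fun ε : ℝ =>
    (1 / (2 * Real.pi)) * ∫ ξ : ℝ, Complex.exp (Complex.I * x * ξ) *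
      Complex.exp (-(Complex.I * ξ ^ 4)) * Complex.exp (-((ε * |ξ| : ℝ) : ℂ))

/-- `M = 1/(B(0)Γ(3/4))`. -/
def Mconst : ℂ := 1 / (Bker 0 * Complex.Gamma (3 / 4))

/-- Duhamel boundary forcing operator of order `0`:
`L⁰f(t,x) = M ∫₀ᵗ B(x/(t-t')^{1/4}) (t-t')^{-1/4} I_{-3/4}f(t') dt'`. -/
def Lzero (f : ℝ → ℂ) (t x : ℝ) : ℂ :=
  Mconst * ∫ t' in (0 : ℝ)..t,
    Bker (x / (t - t') ^ ((1 : ℝ) / 4)) * (((t - t') ^ ((1 : ℝ) / 4) : ℝ) : ℂ)⁻¹ *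
      RL (-(3 : ℂ) / 4) f t'

/-- The function `x ↦ x₋^μ = (-x)₊^μ`. -/
def negPartPow (μ : ℂ) (x : ℝ) : ℂ := if x < 0 then ((-x : ℝ) : ℂ) ^ μ else 0

/-- Duhamel boundary forcing operator of order `λ` (for `Re λ > -4`):
`L^λ g(t,x) = [x₋^{λ-1}/Γ(λ) ∗ L⁰(I_{-λ/4}g)(t,·)](x)`, realized through the identity
`L^λ g(t,x) = iM x₋^{λ+3}/Γ(λ+4) I_{-3/4-λ/4}g(t)
  + i ∫ₓ^∞ (y-x)^{λ+3}/Γ(λ+4) L⁰(∂ₜ I_{-λ/4}g)(t,y) dy`. -/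
def Llam (lam : ℂ) (g : ℝ → ℂ) (t x : ℝ) : ℂ :=
  Complex.I * Mconst * (negPartPow (lam + 3) x / Complex.Gamma (lam + 4)) *
      RL (-(3 : ℂ) / 4 - lam / 4) g t
  + Complex.I * (1 / Complex.Gamma (lam + 4)) *
      ∫ y in Set.Ioi x, ((y - x : ℝ) : ℂ) ^ (lam + 3) *
        Lzero (RL (-lam / 4) (deriv g)) t y

/-- The integrand `exp (i x ξ - i ξ⁴ - ε ξ)` of the regularized oscillatory integral on the
half-line. -/
def oscExp (ε x ξ : ℝ) : ℂ :=
  Complex.exp ((Complex.I * x - ε) * ξ - Complex.I * ξ ^ 4)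

/-- The amplitude produced by integrating `oscExp` by parts against `ξ / (1 - 4 i ξ⁴)`. -/
def oscAmp (ε x ξ : ℝ) : ℂ :=
  ξ * (Complex.I * x - ε) / (1 - 4 * Complex.I * ξ ^ 4) +
    16 * Complex.I * ξ ^ 4 / (1 - 4 * Complex.I * ξ ^ 4) ^ 2

lemma norm_oscExp (ε x ξ : ℝ) : ‖oscExp ε x ξ‖ = Real.exp (-(ε * ξ)) := by
  rw [oscExp, Complex.norm_exp]
  congr 1
  have : (Complex.I * x - ε) * ξ - Complex.I * (ξ : ℂ) ^ 4 =
      ((-(ε * ξ) : ℝ) : ℂ) + ((x * ξ - ξ ^ 4 : ℝ) : ℂ) * Complex.I := by push_cast; ring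
  rw [this]
  simp only [Complex.add_re, Complex.re_ofReal_mul, Complex.ofReal_re, Complex.I_re, mul_zero,
    add_zero]

lemma continuous_oscExp : Continuous fun p : ℝ × ℝ × ℝ => oscExp p.1 p.2.1 p.2.2 := by
  unfold oscExp; fun_prop

lemma norm_oscExp_le_one {ε ξ : ℝ} (hε : 0 ≤ ε) (hξ : 0 ≤ ξ) (x : ℝ) : ‖oscExp ε x ξ‖ ≤ 1 := by
  rw [norm_oscExp, Real.exp_le_one_iff]
  nlinarith [mul_nonneg hε hξ]

lemma integrableOn_oscExp {ε : ℝ} (hε : 0 < ε) (x : ℝ) :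
    IntegrableOn (oscExp ε x) (Ioi 0) := by
  have h : IntegrableOn (fun ξ : ℝ => Real.exp (-ε * ξ)) (Ioi 0) := exp_neg_integrableOn_Ioi 0 hε
  refine Integrable.mono' h ?_ (ae_of_all _ fun ξ => ?_)
  · exact (continuous_oscExp.comp (by fun_prop : Continuous fun ξ : ℝ => (ε, x, ξ))
      ).aestronglyMeasurable
  · rw [norm_oscExp]; simp

lemma normSq_quartic (ξ : ℝ) :
    ‖(1 - 4 * Complex.I * (ξ : ℂ) ^ 4)‖ ^ 2 = 1 + 16 * ξ ^ 8 := by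
  have : (1 - 4 * Complex.I * (ξ : ℂ) ^ 4) = ((1 : ℝ) : ℂ) + ((-4 * ξ ^ 4 : ℝ) : ℂ) * Complex.I := by
    push_cast; ring
  rw [this, ← Complex.normSq_eq_norm_sq, Complex.normSq_add_mul_I]
  ring

lemma one_le_norm_quartic (ξ : ℝ) : 1 ≤ ‖(1 - 4 * Complex.I * (ξ : ℂ) ^ 4)‖ := by
  have h := normSq_quartic ξ
  have h8 : 0 ≤ ξ ^ 8 := by positivity
  nlinarith [norm_nonneg (1 - 4 * Complex.I * (ξ : ℂ) ^ 4)]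

lemma four_mul_le_norm_quartic (ξ : ℝ) : 4 * ξ ^ 4 ≤ ‖(1 - 4 * Complex.I * (ξ : ℂ) ^ 4)‖ := by
  have h := normSq_quartic ξ
  refine le_of_sq_le_sq ?_ (norm_nonneg _)
  rw [h]; nlinarith

lemma quartic_ne_zero (ξ : ℝ) : (1 - 4 * Complex.I * (ξ : ℂ) ^ 4) ≠ 0 := by
  rw [← norm_pos_iff]; linarith [one_le_norm_quartic ξ]

lemma one_add_sq_le_norm_quartic (ξ : ℝ) :
    1 + ξ ^ 2 ≤ 2 * ‖(1 - 4 * Complex.I * (ξ : ℂ) ^ 4)‖ := by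
  have h1 := one_le_norm_quartic ξ
  have h2 := four_mul_le_norm_quartic ξ
  nlinarith [sq_nonneg (ξ ^ 2 - 1), sq_nonneg (ξ ^ 2)]

lemma mul_one_add_sq_le_norm_quartic {ξ : ℝ} (hξ : 0 ≤ ξ) :
    ξ * (1 + ξ ^ 2) ≤ 2 * ‖(1 - 4 * Complex.I * (ξ : ℂ) ^ 4)‖ := by
  have h1 := one_le_norm_quartic ξ
  have h2 := four_mul_le_norm_quartic ξ
  rcases le_total ξ 1 with h | h
  · nlinarith [mul_nonneg hξ (sub_nonneg.2 h)]
  · nlinarith [pow_le_pow_right₀ h (show 1 ≤ 4 by norm_num),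
      pow_le_pow_right₀ h (show 3 ≤ 4 by norm_num)]

lemma norm_oscAmp_le {ξ : ℝ} (hξ : 0 ≤ ξ) (ε x : ℝ) :
    ‖oscAmp ε x ξ‖ ≤ (2 * (|x| + |ε|) + 8) * (1 + ξ ^ 2)⁻¹ := by
  have hq := one_le_norm_quartic ξ
  have hq4 := four_mul_le_norm_quartic ξ
  have hq2 := one_add_sq_le_norm_quartic ξ
  have hq3 := mul_one_add_sq_le_norm_quartic hξ
  unfold oscAmp
  set q := (1 - 4 * Complex.I * (ξ : ℂ) ^ 4) with hqdef
  have hpos : 0 < 1 + ξ ^ 2 := by positivity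
  have hqp : 0 < ‖q‖ := by linarith
  have e1 : ‖(ξ : ℂ) * (Complex.I * x - ε) / q‖ ≤ 2 * (|x| + |ε|) * (1 + ξ ^ 2)⁻¹ := by
    rw [norm_div, norm_mul, Complex.norm_real, Real.norm_of_nonneg hξ]
    have : ‖Complex.I * (x : ℂ) - ε‖ ≤ |x| + |ε| := by
      refine (norm_sub_le _ _).trans ?_
      simp
    rw [← div_eq_mul_inv, div_le_div_iff₀ hqp hpos]
    calc ξ * ‖Complex.I * (x : ℂ) - ε‖ * (1 + ξ ^ 2)
        ≤ ξ * (|x| + |ε|) * (1 + ξ ^ 2) := by gcongr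
      _ = (|x| + |ε|) * (ξ * (1 + ξ ^ 2)) := by ring
      _ ≤ (|x| + |ε|) * (2 * ‖q‖) := by gcongr
      _ = _ := by ring
  have e2 : ‖16 * Complex.I * (ξ : ℂ) ^ 4 / q ^ 2‖ ≤ 8 * (1 + ξ ^ 2)⁻¹ := by
    have : ‖16 * Complex.I * (ξ : ℂ) ^ 4 / q ^ 2‖ = 16 * ξ ^ 4 / ‖q‖ ^ 2 := by
      simp [abs_of_nonneg hξ]
    rw [this, ← div_eq_mul_inv, div_le_div_iff₀ (by positivity) hpos]
    nlinarith [mul_le_mul hq4 hq2 hpos.le hqp.le]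
  calc _ ≤ _ := norm_add_le _ _
    _ ≤ _ := add_le_add e1 e2
    _ = _ := by ring

lemma continuous_oscAmp : Continuous fun p : ℝ × ℝ × ℝ => oscAmp p.1 p.2.1 p.2.2 := by
  unfold oscAmp
  refine Continuous.add (Continuous.div ?_ ?_ ?_) (Continuous.div ?_ ?_ ?_) <;>
    first
    | fun_prop
    | exact fun p => quartic_ne_zero _
    | exact fun p => pow_ne_zero _ (quartic_ne_zero _)

lemma continuous_oscExp_mul_oscAmp :
    Continuous fun p : ℝ × ℝ × ℝ => oscExp p.1 p.2.1 p.2.2 * oscAmp p.1 p.2.1 p.2.2 :=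
  continuous_oscExp.mul continuous_oscAmp

lemma norm_oscExp_mul_oscAmp_le {ε ξ : ℝ} (hε : 0 ≤ ε) (hξ : 0 ≤ ξ) (x : ℝ) :
    ‖oscExp ε x ξ * oscAmp ε x ξ‖ ≤ (2 * (|x| + ε) + 8) * (1 + ξ ^ 2)⁻¹ := by
  rw [norm_mul]
  have h := norm_oscAmp_le hξ ε x
  rw [abs_of_nonneg hε] at h
  calc _ ≤ 1 * ‖oscAmp ε x ξ‖ := by
        gcongr; exact norm_oscExp_le_one hε hξ x
    _ ≤ _ := by rwa [one_mul]

lemma integrableOn_oscExp_mul_oscAmp {ε : ℝ} (hε : 0 ≤ ε) (x : ℝ) :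
    IntegrableOn (fun ξ => oscExp ε x ξ * oscAmp ε x ξ) (Ioi 0) := by
  refine Integrable.mono' ((integrable_inv_one_add_sq.integrableOn (s := Ioi (0 : ℝ))).const_mul
    (2 * (|x| + ε) + 8)) ?_ ?_
  · exact (continuous_oscExp_mul_oscAmp.comp
      (by fun_prop : Continuous fun ξ : ℝ => (ε, x, ξ))).aestronglyMeasurable
  · filter_upwards [ae_restrict_mem measurableSet_Ioi] with ξ hξ
    exact norm_oscExp_mul_oscAmp_le hε (le_of_lt hξ) x

lemma hasDerivAt_oscExp (ε x ξ : ℝ) :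
    HasDerivAt (oscExp ε x)
      (oscExp ε x ξ * (Complex.I * x - ε - 4 * Complex.I * ξ ^ 3)) ξ := by
  have h0 : HasDerivAt (fun ξ : ℝ => (ξ : ℂ)) 1 ξ := Complex.ofRealCLM.hasDerivAt
  have h1 := ((h0.const_mul (Complex.I * x - ε)).sub
    ((h0.pow 4).const_mul Complex.I)).cexp
  refine h1.congr_deriv ?_
  change oscExp ε x ξ * _ = oscExp ε x ξ * _
  push_cast
  ring

lemma integral_oscExp {ε : ℝ} (hε : 0 < ε) (x : ℝ) :
    ∫ ξ in Ioi (0 : ℝ), oscExp ε x ξ = -∫ ξ in Ioi (0 : ℝ), oscExp ε x ξ * oscAmp ε x ξ := by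
  have hd : ∀ ξ ∈ Ici (0 : ℝ), HasDerivAt
      (fun ξ : ℝ => (ξ : ℂ) * oscExp ε x ξ / (1 - 4 * Complex.I * ξ ^ 4))
      (oscExp ε x ξ + oscExp ε x ξ * oscAmp ε x ξ) ξ := by
    intro ξ _
    have h0 : HasDerivAt (fun ξ : ℝ => (ξ : ℂ)) 1 ξ := Complex.ofRealCLM.hasDerivAt
    have h1 := (h0.mul (hasDerivAt_oscExp ε x ξ)).div
      (((h0.pow 4).const_mul (4 * Complex.I)).const_sub 1) (quartic_ne_zero ξ)
    refine h1.congr_deriv ?_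
    have hq := quartic_ne_zero ξ
    simp only [oscAmp, Pi.mul_apply, Pi.pow_apply]
    generalize hQ : (1 - 4 * Complex.I * (ξ : ℂ) ^ 4) = q at hq ⊢
    field_simp
    rw [← hQ]
    push_cast
    ring
  have hlim : Tendsto (fun ξ : ℝ => (ξ : ℂ) * oscExp ε x ξ / (1 - 4 * Complex.I * ξ ^ 4))
      atTop (nhds 0) := by
    refine squeeze_zero_norm' (a := fun ξ : ℝ => 2 * (1 + ξ ^ 2)⁻¹) ?_ ?_
    · filter_upwards [eventually_ge_atTop 0] with ξ hξ
      rw [norm_div, norm_mul, Complex.norm_real, Real.norm_of_nonneg hξ, ← div_eq_mul_inv,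
        div_le_div_iff₀ (by linarith [one_le_norm_quartic ξ]) (by positivity)]
      have := norm_oscExp_le_one hε.le hξ x
      have h3 := mul_one_add_sq_le_norm_quartic hξ
      calc ξ * ‖oscExp ε x ξ‖ * (1 + ξ ^ 2) ≤ ξ * 1 * (1 + ξ ^ 2) := by gcongr
        _ ≤ _ := by linarith
    · have : Tendsto (fun ξ : ℝ => 1 + ξ ^ 2) atTop atTop :=
        tendsto_atTop_add_const_left _ _ (tendsto_pow_atTop two_ne_zero)
      simpa using this.inv_tendsto_atTop.const_mul 2
  have hi := integrableOn_oscExp hε x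
  have hi' := integrableOn_oscExp_mul_oscAmp hε.le x
  have := integral_Ioi_of_hasDerivAt_of_tendsto' hd (hi.add hi') hlim
  rw [integral_add hi hi'] at this
  rw [eq_neg_iff_add_eq_zero, this]
  simp

/-- The regularization of `Bker`. -/
def Breg (ε x : ℝ) : ℂ :=
  (1 / (2 * Real.pi)) * ∫ ξ : ℝ, Complex.exp (Complex.I * x * ξ) *
      Complex.exp (-(Complex.I * ξ ^ 4)) * Complex.exp (-((ε * |ξ| : ℝ) : ℂ))

lemma regularized_eq_oscExp (ε x : ℝ) {ξ : ℝ} (hξ : 0 ≤ ξ) :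
    Complex.exp (Complex.I * x * ξ) * Complex.exp (-(Complex.I * ξ ^ 4)) *
      Complex.exp (-((ε * |ξ| : ℝ) : ℂ)) = oscExp ε x ξ := by
  rw [oscExp, ← Complex.exp_add, ← Complex.exp_add, abs_of_nonneg hξ]
  congr 1
  push_cast
  ring

lemma regularized_neg_eq_oscExp (ε x : ℝ) {ξ : ℝ} (hξ : 0 ≤ ξ) :
    Complex.exp (Complex.I * x * (-ξ : ℝ)) * Complex.exp (-(Complex.I * (-ξ : ℝ) ^ 4)) *
      Complex.exp (-((ε * |-ξ| : ℝ) : ℂ)) = oscExp ε (-x) ξ := by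
  rw [oscExp, ← Complex.exp_add, ← Complex.exp_add, abs_neg, abs_of_nonneg hξ]
  congr 1
  push_cast
  ring

lemma integrable_regularized {ε : ℝ} (hε : 0 < ε) (x : ℝ) :
    Integrable fun ξ : ℝ => Complex.exp (Complex.I * x * ξ) *
      Complex.exp (-(Complex.I * ξ ^ 4)) * Complex.exp (-((ε * |ξ| : ℝ) : ℂ)) := by
  rw [← integrableOn_univ, ← Iic_union_Ioi (a := (0 : ℝ))]
  refine IntegrableOn.union ?_ ?_
  · rw [integrableOn_Iic_iff_integrableOn_Iio]
    rw [← (Measure.measurePreserving_neg (volume : Measure ℝ)).integrableOn_comp_preimage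
      (Homeomorph.neg ℝ).measurableEmbedding]
    simp only [neg_preimage, neg_Iio, neg_zero]
    refine (integrableOn_oscExp hε (-x)).congr_fun (fun ξ hξ => ?_) measurableSet_Ioi
    exact (regularized_neg_eq_oscExp ε x (le_of_lt hξ)).symm
  · refine (integrableOn_oscExp hε x).congr_fun (fun ξ hξ => ?_) measurableSet_Ioi
    exact (regularized_eq_oscExp ε x (le_of_lt hξ)).symm

lemma Breg_eq {ε : ℝ} (hε : 0 < ε) (x : ℝ) :
    Breg ε x = -(1 / (2 * Real.pi)) * ((∫ ξ in Ioi (0 : ℝ), oscExp ε x ξ * oscAmp ε x ξ) +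
      ∫ ξ in Ioi (0 : ℝ), oscExp ε (-x) ξ * oscAmp ε (-x) ξ) := by
  have hi := integrable_regularized hε x
  have h1 : ∫ ξ in Ioi (0 : ℝ), Complex.exp (Complex.I * x * ξ) *
      Complex.exp (-(Complex.I * ξ ^ 4)) * Complex.exp (-((ε * |ξ| : ℝ) : ℂ)) =
      ∫ ξ in Ioi (0 : ℝ), oscExp ε x ξ :=
    setIntegral_congr_fun measurableSet_Ioi
      fun ξ hξ => regularized_eq_oscExp ε x (le_of_lt hξ)
  have h2 : ∫ ξ in Iic (0 : ℝ), Complex.exp (Complex.I * x * ξ) *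
      Complex.exp (-(Complex.I * ξ ^ 4)) * Complex.exp (-((ε * |ξ| : ℝ) : ℂ)) =
      ∫ ξ in Ioi (0 : ℝ), oscExp ε (-x) ξ := by
    rw [← neg_zero, ← integral_comp_neg_Ioi, neg_zero]
    exact setIntegral_congr_fun measurableSet_Ioi
      fun ξ hξ => regularized_neg_eq_oscExp ε x (le_of_lt hξ)
  rw [Breg, ← intervalIntegral.integral_Iic_add_Ioi hi.integrableOn hi.integrableOn (b := 0),
    h1, h2, integral_oscExp hε, integral_oscExp hε]
  ring

lemma tendsto_integral_oscExp_mul_oscAmp (x : ℝ) :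
    Tendsto (fun ε : ℝ => ∫ ξ in Ioi (0 : ℝ), oscExp ε x ξ * oscAmp ε x ξ)
      (nhdsWithin 0 (Ioi 0)) (nhds (∫ ξ in Ioi (0 : ℝ), oscExp 0 x ξ * oscAmp 0 x ξ)) := by
  refine tendsto_integral_filter_of_dominated_convergence
    (fun ξ => (2 * (|x| + 1) + 8) * (1 + ξ ^ 2)⁻¹) ?_ ?_ ?_ ?_
  · exact Eventually.of_forall fun ε => (continuous_oscExp_mul_oscAmp.comp
      (by fun_prop : Continuous fun ξ : ℝ => (ε, x, ξ))).aestronglyMeasurable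
  · filter_upwards [Ioo_mem_nhdsGT (zero_lt_one (α := ℝ))] with ε hε
    filter_upwards [ae_restrict_mem measurableSet_Ioi] with ξ hξ
    refine (norm_oscExp_mul_oscAmp_le hε.1.le (le_of_lt hξ) x).trans ?_
    gcongr
    exact hε.2.le
  · exact (integrable_inv_one_add_sq.integrableOn).const_mul _
  · refine ae_of_all _ fun ξ => tendsto_nhdsWithin_of_tendsto_nhds ?_
    exact (continuous_oscExp_mul_oscAmp.comp
      (by fun_prop : Continuous fun ε : ℝ => (ε, x, ξ))).tendsto 0

lemma tendsto_Breg (x : ℝ) :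
    Tendsto (fun ε => Breg ε x) (nhdsWithin 0 (Ioi 0)) (nhds (Bker x)) := by
  refine tendsto_nhds_limUnder ⟨-(1 / (2 * Real.pi)) *
    ((∫ ξ in Ioi (0 : ℝ), oscExp 0 x ξ * oscAmp 0 x ξ) +
      ∫ ξ in Ioi (0 : ℝ), oscExp 0 (-x) ξ * oscAmp 0 (-x) ξ), ?_⟩
  refine (((tendsto_integral_oscExp_mul_oscAmp x).add
    (tendsto_integral_oscExp_mul_oscAmp (-x))).const_mul _).congr' ?_
  filter_upwards [self_mem_nhdsWithin] with ε hε
  exact (Breg_eq hε x).symm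

lemma norm_integral_oscExp_mul_oscAmp_le {ε : ℝ} (hε : 0 ≤ ε) (x : ℝ) :
    ‖∫ ξ in Ioi (0 : ℝ), oscExp ε x ξ * oscAmp ε x ξ‖ ≤
      (2 * (|x| + ε) + 8) * (Real.pi / 2) := by
  refine (norm_integral_le_of_norm_le (g := fun ξ : ℝ => (2 * (|x| + ε) + 8) * (1 + ξ ^ 2)⁻¹)
    ((integrable_inv_one_add_sq.integrableOn).const_mul _) ?_).trans_eq ?_
  · filter_upwards [ae_restrict_mem measurableSet_Ioi] with ξ hξ
    exact norm_oscExp_mul_oscAmp_le hε (le_of_lt hξ) x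
  · rw [integral_const_mul, integral_Ioi_inv_one_add_sq]
    simp

lemma norm_Breg_le {ε : ℝ} (hε : 0 < ε) (hε1 : ε ≤ 1) (x : ℝ) : ‖Breg ε x‖ ≤ |x| + 5 := by
  have h1 := norm_integral_oscExp_mul_oscAmp_le hε.le x
  have h2 := norm_integral_oscExp_mul_oscAmp_le hε.le (-x)
  rw [abs_neg] at h2
  rw [Breg_eq hε, norm_mul]
  have h3 : ‖-(1 / (2 * (Real.pi : ℂ)))‖ = 1 / (2 * Real.pi) := by
    simp [abs_of_pos Real.pi_pos]
  rw [h3, one_div, inv_mul_le_iff₀ (by positivity)]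
  refine (norm_add_le _ _).trans ((add_le_add h1 h2).trans ?_)
  nlinarith [Real.pi_pos]

lemma norm_Bker_le (x : ℝ) : ‖Bker x‖ ≤ |x| + 5 := by
  refine le_of_tendsto (tendsto_Breg x).norm ?_
  filter_upwards [Ioo_mem_nhdsGT (zero_lt_one (α := ℝ))] with ε hε
  exact norm_Breg_le hε.1 hε.2.le x

lemma measurable_Breg (ε : ℝ) : Measurable (Breg ε) := by
  unfold Breg
  refine Measurable.const_mul ?_ _
  have : Continuous fun p : ℝ × ℝ => Complex.exp (Complex.I * p.1 * p.2) *
      Complex.exp (-(Complex.I * p.2 ^ 4)) * Complex.exp (-((ε * |p.2| : ℝ) : ℂ)) := by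
    fun_prop
  exact (this.stronglyMeasurable.integral_prod_right (ν := volume)).measurable

lemma measurable_Bker : Measurable Bker :=
  measurable_of_tendsto_metrizable' (nhdsWithin (0 : ℝ) (Ioi 0)) measurable_Breg
    (tendsto_pi_nhds.2 tendsto_Breg)

/-- The unnormalized inverse Fourier transform `ξ ↦ ∫ e^{ixξ} ψ(x) dx`. -/
def oscFT (ψ : ℝ → ℂ) (ξ : ℝ) : ℂ := ∫ x : ℝ, Complex.exp (Complex.I * x * ξ) * ψ x

lemma norm_exp_I_mul_mul (x ξ : ℝ) : ‖Complex.exp (Complex.I * x * ξ)‖ = 1 := by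
  rw [show Complex.I * (x : ℂ) * ξ = ((x * ξ : ℝ) : ℂ) * Complex.I by push_cast; ring,
    Complex.norm_exp_ofReal_mul_I]

lemma norm_exp_neg_I_quartic (s ξ : ℝ) : ‖Complex.exp (-(Complex.I * s * ξ ^ 4))‖ = 1 := by
  rw [show -(Complex.I * (s : ℂ) * (ξ : ℂ) ^ 4) = ((-(s * ξ ^ 4) : ℝ) : ℂ) * Complex.I by
    push_cast; ring, Complex.norm_exp_ofReal_mul_I]

lemma Breg_div {a : ℝ} (ha : 0 < a) (ε x : ℝ) :
    Breg ε (x / a) * (a : ℂ)⁻¹ = (1 / (2 * Real.pi)) * ∫ ξ : ℝ,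
      Complex.exp (Complex.I * x * ξ) * (Complex.exp (-(Complex.I * (a ^ 4 : ℝ) * ξ ^ 4)) *
        Complex.exp (-((ε * |a * ξ| : ℝ) : ℂ))) := by
  have h := Measure.integral_comp_mul_left (fun ξ : ℝ => Complex.exp (Complex.I * (x / a : ℝ) * ξ) *
      Complex.exp (-(Complex.I * ξ ^ 4)) * Complex.exp (-((ε * |ξ| : ℝ) : ℂ))) a
  rw [abs_of_pos (inv_pos.2 ha), Complex.real_smul] at h
  rw [Breg, mul_assoc, mul_comm _ (a : ℂ)⁻¹, ← Complex.ofReal_inv, ← h]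
  congr 1
  refine integral_congr_ae (ae_of_all _ fun ξ => ?_)
  have ha' : (a : ℂ) ≠ 0 := by exact_mod_cast ha.ne'
  simp only [← Complex.exp_add]
  congr 1
  push_cast
  field_simp
  ring

lemma integral_Breg_div_mul {a ε : ℝ} (ha : 0 < a) (hε : 0 < ε) {ψ : ℝ → ℂ}
    (hψ : Integrable ψ) :
    ∫ x : ℝ, Breg ε (x / a) * (a : ℂ)⁻¹ * ψ x = (1 / (2 * Real.pi)) * ∫ ξ : ℝ,
      Complex.exp (-(Complex.I * (a ^ 4 : ℝ) * ξ ^ 4)) *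
        Complex.exp (-((ε * |a * ξ| : ℝ) : ℂ)) * oscFT ψ ξ := by
  set w : ℝ → ℂ := fun ξ => Complex.exp (-(Complex.I * (a ^ 4 : ℝ) * ξ ^ 4)) *
        Complex.exp (-((ε * |a * ξ| : ℝ) : ℂ)) with hw
  have hwi : Integrable w := by
    have h := (integrable_regularized hε 0).comp_mul_left' ha.ne'
    refine h.congr (ae_of_all _ fun ξ => ?_)
    simp only [hw, ← Complex.exp_add]
    congr 1
    push_cast
    ring
  have hprod : Integrable (fun p : ℝ × ℝ =>
      Complex.exp (Complex.I * p.1 * p.2) * (ψ p.1 * w p.2)) (volume.prod volume) := by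
    refine (hψ.mul_prod hwi).bdd_mul (c := 1) ?_ ?_
    · exact Continuous.aestronglyMeasurable (by fun_prop)
    · exact ae_of_all _ fun p => (norm_exp_I_mul_mul _ _).le
  have h1 : ∀ x : ℝ, Breg ε (x / a) * (a : ℂ)⁻¹ * ψ x = (1 / (2 * Real.pi)) *
      ∫ ξ : ℝ, Complex.exp (Complex.I * x * ξ) * (ψ x * w ξ) := by
    intro x
    rw [Breg_div ha, mul_assoc, ← integral_mul_const]
    congr 1
    refine integral_congr_ae (ae_of_all _ fun ξ => ?_)
    simp only [hw]
    ring
  simp_rw [h1]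
  rw [integral_const_mul, integral_integral_swap hprod]
  congr 1
  refine integral_congr_ae (ae_of_all _ fun ξ => ?_)
  simp only [oscFT]
  rw [← integral_const_mul]
  refine integral_congr_ae (ae_of_all _ fun x => ?_)
  simp only
  ring

/-- Pairing of the kernel `B(x/a)/a` with a test function, computed on the Fourier side. -/
lemma integral_Bker_div_mul {a : ℝ} (ha : 0 < a) {ψ : ℝ → ℂ} (hψ : Continuous ψ)
    (hψc : HasCompactSupport ψ) (hF : Integrable (oscFT ψ)) :
    ∫ x : ℝ, Bker (x / a) * (a : ℂ)⁻¹ * ψ x = (1 / (2 * Real.pi)) * ∫ ξ : ℝ,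
      Complex.exp (-(Complex.I * (a ^ 4 : ℝ) * ξ ^ 4)) * oscFT ψ ξ := by
  have hψi := hψ.integrable_of_hasCompactSupport (μ := volume) hψc
  have hL : Tendsto (fun ε => ∫ x : ℝ, Breg ε (x / a) * (a : ℂ)⁻¹ * ψ x)
      (nhdsWithin 0 (Ioi 0)) (nhds (∫ x : ℝ, Bker (x / a) * (a : ℂ)⁻¹ * ψ x)) := by
    refine tendsto_integral_filter_of_dominated_convergence
      (fun x => (|x / a| + 5) * a⁻¹ * ‖ψ x‖) ?_ ?_ ?_ ?_
    · refine Eventually.of_forall fun ε => AEStronglyMeasurable.mul ?_ hψ.aestronglyMeasurable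
      exact (((measurable_Breg ε).comp (measurable_id.div_const a)).mul_const
        _).aestronglyMeasurable
    · filter_upwards [Ioo_mem_nhdsGT (zero_lt_one (α := ℝ))] with ε hε
      refine ae_of_all _ fun x => ?_
      rw [norm_mul, norm_mul, norm_inv, Complex.norm_real, Real.norm_of_nonneg ha.le]
      gcongr
      exact norm_Breg_le hε.1 hε.2.le _
    · refine Continuous.integrable_of_hasCompactSupport (by fun_prop) ?_
      exact hψc.norm.mul_left
    · exact ae_of_all _ fun x => ((tendsto_Breg _).mul_const _).mul_const _
  have hR : Tendsto (fun ε : ℝ => (1 / (2 * Real.pi)) * ∫ ξ : ℝ,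
      Complex.exp (-(Complex.I * (a ^ 4 : ℝ) * ξ ^ 4)) *
        Complex.exp (-((ε * |a * ξ| : ℝ) : ℂ)) * oscFT ψ ξ)
      (nhdsWithin 0 (Ioi 0)) (nhds ((1 / (2 * Real.pi)) * ∫ ξ : ℝ,
      Complex.exp (-(Complex.I * (a ^ 4 : ℝ) * ξ ^ 4)) * oscFT ψ ξ)) := by
    refine Tendsto.const_mul _ (tendsto_integral_filter_of_dominated_convergence
      (fun ξ => ‖oscFT ψ ξ‖) ?_ ?_ hF.norm ?_)
    · exact Eventually.of_forall fun ε =>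
        (Continuous.aestronglyMeasurable (by fun_prop)).mul hF.aestronglyMeasurable
    · filter_upwards [self_mem_nhdsWithin] with ε hε
      refine ae_of_all _ fun ξ => ?_
      rw [norm_mul, norm_mul, norm_exp_neg_I_quartic, ← Complex.ofReal_neg,
        Complex.norm_exp_ofReal, one_mul]
      refine mul_le_of_le_one_left (norm_nonneg _) ?_
      rw [Real.exp_le_one_iff, neg_nonpos]
      exact mul_nonneg (le_of_lt hε) (abs_nonneg _)
    · refine ae_of_all _ fun ξ => tendsto_nhdsWithin_of_tendsto_nhds ?_
      have : Continuous fun ε : ℝ => Complex.exp (-(Complex.I * (a ^ 4 : ℝ) * ξ ^ 4)) *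
        Complex.exp (-((ε * |a * ξ| : ℝ) : ℂ)) * oscFT ψ ξ := by fun_prop
      simpa using this.tendsto 0
  refine tendsto_nhds_unique hL (hR.congr' ?_)
  filter_upwards [self_mem_nhdsWithin] with ε hε
  exact (integral_Breg_div_mul ha hε hψi).symm

/-- Test functions on the `(t, x)`-plane. -/
def IsTest (F : ℝ × ℝ → ℂ) : Prop := ContDiff ℝ (⊤ : ℕ∞) F ∧ HasCompactSupport F

/-- The partial derivative in the first variable. -/
def partialT (F : ℝ × ℝ → ℂ) (p : ℝ × ℝ) : ℂ := fderiv ℝ F p (1, 0)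

/-- The partial derivative in the second variable. -/
def partialX (F : ℝ × ℝ → ℂ) (p : ℝ × ℝ) : ℂ := fderiv ℝ F p (0, 1)

namespace IsTest

variable {F G : ℝ × ℝ → ℂ}

lemma continuous (hF : IsTest F) : Continuous F := hF.1.continuous

lemma partialT (hF : IsTest F) : IsTest (partialT F) :=
  ⟨(hF.1.fderiv_right (m := (⊤ : ℕ∞)) le_rfl).clm_apply contDiff_const, hF.2.fderiv_apply ℝ _⟩

lemma partialX (hF : IsTest F) : IsTest (partialX F) :=
  ⟨(hF.1.fderiv_right (m := (⊤ : ℕ∞)) le_rfl).clm_apply contDiff_const, hF.2.fderiv_apply ℝ _⟩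

lemma const_mul (hF : IsTest F) (c : ℂ) : IsTest fun p => c * F p :=
  ⟨contDiff_const.mul hF.1, hF.2.mul_left⟩

lemma sub (hF : IsTest F) (hG : IsTest G) : IsTest fun p => F p - G p :=
  ⟨hF.1.sub hG.1, by
    have := hF.2.add (hG.const_mul (-1)).2
    simpa [sub_eq_add_neg, Pi.add_def] using this⟩

lemma hasDerivAt_left (hF : IsTest F) (t x : ℝ) :
    HasDerivAt (fun t => F (t, x)) (_root_.partialT F (t, x)) t :=
  (hF.1.differentiable (by simp) (t, x)).hasFDerivAt.comp_hasDerivAt t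
    ((hasDerivAt_id t).prodMk (hasDerivAt_const t x))

lemma hasDerivAt_right (hF : IsTest F) (t x : ℝ) :
    HasDerivAt (fun x => F (t, x)) (_root_.partialX F (t, x)) x :=
  (hF.1.differentiable (by simp) (t, x)).hasFDerivAt.comp_hasDerivAt x
    ((hasDerivAt_const x t).prodMk (hasDerivAt_id x))

lemma exists_support_bound (hF : IsTest F) :
    ∃ R : ℝ, 0 ≤ R ∧ ∀ t x, (R < |t| ∨ R < |x|) → F (t, x) = 0 := by
  obtain ⟨R, hR⟩ := hF.2.isCompact.isBounded.subset_closedBall (0 : ℝ × ℝ)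
  refine ⟨max R 0, le_max_right _ _, fun t x h => ?_⟩
  by_contra hne
  have h1 := hR (subset_tsupport F hne)
  rw [Metric.mem_closedBall, dist_zero_right, Prod.norm_def, max_le_iff] at h1
  rcases h with h | h
  · exact absurd (h1.1.trans (le_max_left R 0)) (not_le.2 h)
  · exact absurd (h1.2.trans (le_max_left R 0)) (not_le.2 h)

lemma hasCompactSupport_right (hF : IsTest F) (t : ℝ) : HasCompactSupport fun x => F (t, x) := by
  obtain ⟨R, -, hR⟩ := hF.exists_support_bound
  refine HasCompactSupport.intro (isCompact_Icc (a := -R) (b := R)) fun x hx => hR t x (Or.inr ?_)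
  by_contra h
  exact hx (abs_le.1 (not_lt.1 h))

lemma hasCompactSupport_left (hF : IsTest F) (x : ℝ) : HasCompactSupport fun t => F (t, x) := by
  obtain ⟨R, -, hR⟩ := hF.exists_support_bound
  refine HasCompactSupport.intro (isCompact_Icc (a := -R) (b := R)) fun t ht => hR t x (Or.inl ?_)
  by_contra h
  exact ht (abs_le.1 (not_lt.1 h))

lemma continuous_right (hF : IsTest F) (t : ℝ) : Continuous fun x => F (t, x) :=
  hF.continuous.comp (by fun_prop)

lemma integrable_exp_mul (hF : IsTest F) (t ξ : ℝ) :
    Integrable fun x : ℝ => Complex.exp (Complex.I * x * ξ) * F (t, x) :=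
  Continuous.integrable_of_hasCompactSupport
    (Continuous.mul (by fun_prop) (hF.continuous_right t)) (hF.hasCompactSupport_right t).mul_left

lemma oscFT_partialX (hF : IsTest F) (t ξ : ℝ) :
    oscFT (fun x => _root_.partialX F (t, x)) ξ =
      -(Complex.I * ξ) * oscFT (fun x => F (t, x)) ξ := by
  have hexp : ∀ x : ℝ, HasDerivAt (fun x : ℝ => Complex.exp (Complex.I * x * ξ))
      (Complex.exp (Complex.I * x * ξ) * (Complex.I * ξ)) x := by
    intro x
    have h0 : HasDerivAt (fun x : ℝ => (x : ℂ)) 1 x := Complex.ofRealCLM.hasDerivAt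
    simpa using ((h0.const_mul Complex.I).mul_const (ξ : ℂ)).cexp
  have hi := (hF.integrable_exp_mul t ξ).const_mul (Complex.I * ξ)
  rw [oscFT, integral_mul_deriv_eq_deriv_mul_of_integrable (fun x _ => hexp x)
    (fun x _ => hF.hasDerivAt_right t x) (hF.partialX.integrable_exp_mul t ξ)
    (hi.congr (ae_of_all _ fun x => ?_)) (hF.integrable_exp_mul t ξ), oscFT, neg_mul,
    ← integral_const_mul]
  · congr 1
    refine integral_congr_ae (ae_of_all _ fun x => ?_)
    simp only
    ring
  · simp only [Pi.mul_apply]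
    ring

lemma exists_norm_oscFT_le (hF : IsTest F) :
    ∃ C : ℝ, 0 ≤ C ∧ ∀ t ξ, ‖oscFT (fun x => F (t, x)) ξ‖ ≤ C := by
  obtain ⟨R, hR0, hR⟩ := hF.exists_support_bound
  obtain ⟨C, hC⟩ := hF.2.exists_bound_of_continuous hF.continuous
  have hC0 : 0 ≤ C := (norm_nonneg _).trans (hC 0)
  refine ⟨C * (volume (Icc (-R) R)).toReal, by positivity, fun t ξ => ?_⟩
  rw [oscFT, ← setIntegral_eq_integral_of_forall_compl_eq_zero (s := Icc (-R) R)]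
  · refine norm_setIntegral_le_of_norm_le_const (by simp) fun x _ => ?_
    rw [norm_mul, norm_exp_I_mul_mul, one_mul]
    exact hC _
  · intro x hx
    rw [hR t x (Or.inr ?_), mul_zero]
    by_contra h
    exact hx (abs_le.1 (not_lt.1 h))

lemma oscFT_sub (hF : IsTest F) (hG : IsTest G) (t ξ : ℝ) :
    oscFT (fun x => F (t, x) - G (t, x)) ξ =
      oscFT (fun x => F (t, x)) ξ - oscFT (fun x => G (t, x)) ξ := by
  rw [oscFT, oscFT, oscFT, ← integral_sub (hF.integrable_exp_mul t ξ) (hG.integrable_exp_mul t ξ)]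
  simp_rw [mul_sub]

/-- Quadratic decay of the partial Fourier transform, uniformly in `t`. -/
lemma exists_norm_oscFT_le_decay (hF : IsTest F) :
    ∃ C : ℝ, 0 ≤ C ∧ ∀ t ξ, ‖oscFT (fun x => F (t, x)) ξ‖ ≤ C * (1 + ξ ^ 2)⁻¹ := by
  obtain ⟨C, hC0, hC⟩ := (hF.sub hF.partialX.partialX).exists_norm_oscFT_le
  refine ⟨C, hC0, fun t ξ => ?_⟩
  have h := hC t ξ
  rw [hF.oscFT_sub hF.partialX.partialX, hF.partialX.oscFT_partialX, hF.oscFT_partialX] at h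
  have h2 : oscFT (fun x => F (t, x)) ξ -
      -(Complex.I * ξ) * (-(Complex.I * ξ) * oscFT (fun x => F (t, x)) ξ) =
      ((1 + ξ ^ 2 : ℝ) : ℂ) * oscFT (fun x => F (t, x)) ξ := by
    push_cast
    linear_combination (-(ξ : ℂ) ^ 2 * oscFT (fun x => F (t, x)) ξ) * Complex.I_sq
  have hpos : 0 < 1 + ξ ^ 2 := by positivity
  rw [h2, norm_mul, Complex.norm_real, Real.norm_of_nonneg hpos.le] at h
  rw [← div_eq_mul_inv, le_div_iff₀ hpos]
  linarith

lemma stronglyMeasurable_oscFT (hF : IsTest F) :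
    StronglyMeasurable fun p : ℝ × ℝ => oscFT (fun x => F (p.1, x)) p.2 := by
  have hF' := hF.continuous
  have : Continuous fun q : (ℝ × ℝ) × ℝ =>
      Complex.exp (Complex.I * q.2 * q.1.2) * F (q.1.1, q.2) := by fun_prop
  exact this.stronglyMeasurable.integral_prod_right (ν := volume)

lemma integrable_oscFT (hF : IsTest F) (t : ℝ) : Integrable (oscFT fun x => F (t, x)) := by
  obtain ⟨C, -, hC⟩ := hF.exists_norm_oscFT_le_decay
  refine (integrable_inv_one_add_sq.const_mul C).mono' ?_ (ae_of_all _ (hC t))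
  exact (hF.stronglyMeasurable_oscFT.comp_measurable
    (measurable_prodMk_left (x := t))).aestronglyMeasurable

end IsTest

lemma integral_oscFT {ψ : ℝ → ℂ} (hψ : Continuous ψ) (hi : Integrable ψ)
    (hF : Integrable (oscFT ψ)) : ∫ ξ, oscFT ψ ξ = 2 * Real.pi * ψ 0 := by
  have h2pi : -(2 * Real.pi) ≠ 0 := by simp [Real.pi_ne_zero]
  have key : FourierTransform.fourier ψ = fun w : ℝ => oscFT ψ (-(2 * Real.pi) * w) := by
    ext w
    rw [Real.fourier_real_eq_integral_exp_smul, oscFT]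
    refine integral_congr_ae (ae_of_all _ fun x => ?_)
    simp only [smul_eq_mul]
    congr 2
    push_cast
    ring
  have hFi : Integrable (FourierTransform.fourier ψ) := by
    rw [key]
    exact hF.comp_mul_left' h2pi
  have h := congrFun (hψ.fourierInv_fourier_eq hi hFi) 0
  rw [Real.fourierInv_eq'] at h
  simp only [inner_zero_right, mul_zero, Complex.ofReal_zero, zero_mul, Complex.exp_zero,
    one_smul] at h
  rw [key, Measure.integral_comp_mul_left, abs_inv, abs_neg, abs_of_pos Real.two_pi_pos] at h
  rw [← h, Complex.real_smul]
  push_cast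
  field_simp [Real.pi_ne_zero]

/-- The formal adjoint of `i∂ₜ - ∂ₓ⁴` applied to `F`. -/
def adjointOp (F : ℝ × ℝ → ℂ) (p : ℝ × ℝ) : ℂ :=
  -Complex.I * partialT F p - partialX (partialX (partialX (partialX F))) p

lemma IsTest.adjointOp {F : ℝ × ℝ → ℂ} (hF : IsTest F) : IsTest (adjointOp F) :=
  (hF.partialT.const_mul _).sub hF.partialX.partialX.partialX.partialX

lemma IsTest.oscFT_adjointOp {F : ℝ × ℝ → ℂ} (hF : IsTest F) (t ξ : ℝ) :
    oscFT (fun x => _root_.adjointOp F (t, x)) ξ =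
      ∫ x : ℝ, Complex.exp (Complex.I * x * ξ) *
        (-Complex.I * _root_.partialT F (t, x) - ξ ^ 4 * F (t, x)) := by
  have h4 : IsTest fun p => (ξ : ℂ) ^ 4 * F p := hF.const_mul _
  have h := hF.partialT.const_mul (-Complex.I)
  unfold _root_.adjointOp
  rw [h.oscFT_sub hF.partialX.partialX.partialX.partialX,
    hF.partialX.partialX.partialX.oscFT_partialX, hF.partialX.partialX.oscFT_partialX,
    hF.partialX.oscFT_partialX, hF.oscFT_partialX]
  refine Eq.trans ?_ (h.oscFT_sub h4 t ξ).symm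
  congr 1
  have : oscFT (fun x => (ξ : ℂ) ^ 4 * F (t, x)) ξ = ξ ^ 4 * oscFT (fun x => F (t, x)) ξ := by
    rw [oscFT, oscFT, ← integral_const_mul]
    refine integral_congr_ae (ae_of_all _ fun x => ?_)
    simp only
    ring
  rw [this]
  linear_combination ((ξ : ℂ) ^ 4 * oscFT (fun x => F (t, x)) ξ) * Complex.I_pow_four

lemma hasDerivAt_exp_quartic (u ξ t : ℝ) :
    HasDerivAt (fun t : ℝ => Complex.exp (-(Complex.I * (t - u : ℝ) * ξ ^ 4)))
      (Complex.exp (-(Complex.I * (t - u : ℝ) * ξ ^ 4)) * (-(Complex.I * ξ ^ 4))) t := by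
  have h0 : HasDerivAt (fun t : ℝ => ((t - u : ℝ) : ℂ)) 1 t := by
    simpa using ((hasDerivAt_id t).sub_const u).ofReal_comp
  simpa using ((h0.const_mul Complex.I).mul_const ((ξ : ℂ) ^ 4)).neg.cexp

/-- The adjoint equation at a fixed frequency. -/
lemma IsTest.integral_oscFT_adjointOp {F : ℝ × ℝ → ℂ} (hF : IsTest F) (u ξ : ℝ) :
    ∫ t in Ioi u, Complex.exp (-(Complex.I * (t - u : ℝ) * ξ ^ 4)) *
      oscFT (fun x => _root_.adjointOp F (t, x)) ξ =
      Complex.I * oscFT (fun x => F (u, x)) ξ := by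
  have hT := hF.partialT.continuous
  have hF' := hF.continuous
  set H : ℝ × ℝ → ℂ := fun p => _root_.partialT F p - Complex.I * ξ ^ 4 * F p with hH
  have hHt : IsTest H := hF.partialT.sub (hF.const_mul _)
  have hH' := hHt.continuous
  have h1 : ∀ t : ℝ, Complex.exp (-(Complex.I * (t - u : ℝ) * ξ ^ 4)) *
      oscFT (fun x => _root_.adjointOp F (t, x)) ξ = ∫ x : ℝ,
        (Complex.exp (-(Complex.I * (t - u : ℝ) * ξ ^ 4)) * Complex.exp (Complex.I * x * ξ) *
          -Complex.I) * H (t, x) := by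
    intro t
    rw [hF.oscFT_adjointOp, ← integral_const_mul]
    refine integral_congr_ae (ae_of_all _ fun x => ?_)
    simp only [hH]
    linear_combination (-Complex.exp (-(Complex.I * (t - u : ℝ) * ξ ^ 4)) *
      Complex.exp (Complex.I * x * ξ) * ξ ^ 4 * F (t, x)) * Complex.I_sq
  simp_rw [h1]
  rw [integral_integral_swap]
  · rw [oscFT, ← integral_const_mul]
    refine integral_congr_ae (ae_of_all _ fun x => ?_)
    simp only
    have hd : ∀ t : ℝ, HasDerivAt (fun t : ℝ => (-Complex.I * Complex.exp (Complex.I * x * ξ)) *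
        (Complex.exp (-(Complex.I * (t - u : ℝ) * ξ ^ 4)) * F (t, x)))
        ((Complex.exp (-(Complex.I * (t - u : ℝ) * ξ ^ 4)) * Complex.exp (Complex.I * x * ξ) *
          -Complex.I) * H (t, x)) t := by
      intro t
      refine (((hasDerivAt_exp_quartic u ξ t).mul (hF.hasDerivAt_left t x)).const_mul
        (-Complex.I * Complex.exp (Complex.I * x * ξ))).congr_deriv ?_
      simp only [hH]
      ring
    have hcs := (hF.hasCompactSupport_left x).mul_left
      (f := fun t : ℝ => (-Complex.I * Complex.exp (Complex.I * x * ξ)) *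
        Complex.exp (-(Complex.I * (t - u : ℝ) * ξ ^ 4)))
    rw [integral_Ioi_of_hasDerivAt_of_tendsto' (m := 0) (fun t _ => hd t)]
    · simp
      ring
    · refine Integrable.integrableOn (Continuous.integrable_of_hasCompactSupport (by fun_prop) ?_)
      exact (hHt.hasCompactSupport_left x).mul_left
    · refine (hcs.is_zero_at_infty.mono_left atTop_le_cocompact).congr fun t => ?_
      simp only [Pi.mul_apply, mul_assoc]
  · refine Continuous.integrable_of_hasCompactSupport ?_ ?_
    · fun_prop
    · exact HasCompactSupport.mul_left (f := fun p : ℝ × ℝ =>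
        Complex.exp (-(Complex.I * (p.1 - u : ℝ) * ξ ^ 4)) * Complex.exp (Complex.I * p.2 * ξ) *
          -Complex.I) hHt.2

/-- The kernel of the fourth-order Schrödinger group at time `s > 0`. -/
def groupKernel (s x : ℝ) : ℂ :=
  Bker (x / s ^ ((1 : ℝ) / 4)) * ((s ^ ((1 : ℝ) / 4) : ℝ) : ℂ)⁻¹

lemma measurable_groupKernel : Measurable fun p : ℝ × ℝ => groupKernel p.1 p.2 := by
  unfold groupKernel
  have h := measurable_Bker
  fun_prop

lemma norm_groupKernel_le {s : ℝ} (hs : 0 < s) (x : ℝ) :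
    ‖groupKernel s x‖ ≤ |x| * s ^ (-(1 / 2) : ℝ) + 5 * s ^ (-(1 / 4) : ℝ) := by
  have ha : 0 < s ^ ((1 : ℝ) / 4) := Real.rpow_pos_of_pos hs _
  have e1 : s ^ (-(1 / 4) : ℝ) = (s ^ ((1 : ℝ) / 4))⁻¹ := Real.rpow_neg hs.le _
  have e2 : s ^ (-(1 / 2) : ℝ) = (s ^ ((1 : ℝ) / 4))⁻¹ * (s ^ ((1 : ℝ) / 4))⁻¹ := by
    rw [← e1, ← Real.rpow_add hs]; norm_num
  rw [groupKernel, norm_mul, norm_inv, Complex.norm_real, Real.norm_of_nonneg ha.le, e1, e2]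
  calc _ ≤ (|x / s ^ ((1 : ℝ) / 4)| + 5) * (s ^ ((1 : ℝ) / 4))⁻¹ := by
        gcongr; exact norm_Bker_le _
    _ = _ := by rw [abs_div, abs_of_pos ha]; ring

lemma integral_groupKernel_mul {s : ℝ} (hs : 0 < s) {ψ : ℝ → ℂ} (hψ : Continuous ψ)
    (hψc : HasCompactSupport ψ) (hF : Integrable (oscFT ψ)) :
    ∫ x : ℝ, groupKernel s x * ψ x = (1 / (2 * Real.pi)) * ∫ ξ : ℝ,
      Complex.exp (-(Complex.I * s * ξ ^ 4)) * oscFT ψ ξ := by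
  have h := integral_Bker_div_mul (Real.rpow_pos_of_pos hs ((1 : ℝ) / 4)) hψ hψc hF
  have h4 : (s ^ ((1 : ℝ) / 4)) ^ 4 = s := by
    rw [← Real.rpow_natCast, ← Real.rpow_mul hs.le]; norm_num
  rw [h4] at h
  exact h

/-- The group kernel started at time `u` from `δ₀` solves the equation weakly. -/
lemma IsTest.integral_groupKernel_adjointOp {F : ℝ × ℝ → ℂ} (hF : IsTest F) (u : ℝ) :
    ∫ t in Ioi u, ∫ x : ℝ, groupKernel (t - u) x * _root_.adjointOp F (t, x) =
      Complex.I * F (u, 0) := by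
  have hA := hF.adjointOp
  have h1 : ∫ t in Ioi u, ∫ x : ℝ, groupKernel (t - u) x * _root_.adjointOp F (t, x) =
      ∫ t in Ioi u, (1 / (2 * Real.pi)) * ∫ ξ : ℝ,
        Complex.exp (-(Complex.I * (t - u : ℝ) * ξ ^ 4)) *
          oscFT (fun x => _root_.adjointOp F (t, x)) ξ :=
    setIntegral_congr_fun measurableSet_Ioi fun t ht =>
      integral_groupKernel_mul (sub_pos.2 ht) (hA.continuous_right t)
        (hA.hasCompactSupport_right t) (hA.integrable_oscFT t)
  rw [h1, integral_const_mul, integral_integral_swap]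
  · simp_rw [hF.integral_oscFT_adjointOp u]
    rw [integral_const_mul, integral_oscFT (hF.continuous_right u)
      ((hF.continuous_right u).integrable_of_hasCompactSupport (hF.hasCompactSupport_right u))
      (hF.integrable_oscFT u)]
    have : (Real.pi : ℂ) ≠ 0 := by exact_mod_cast Real.pi_ne_zero
    field_simp
  · obtain ⟨R, hR0, hR⟩ := hA.exists_support_bound
    obtain ⟨C, hC0, hC⟩ := hA.exists_norm_oscFT_le_decay
    have hg : Integrable ((Icc (-R) R).indicator fun _ : ℝ => C) (volume.restrict (Ioi u)) :=
      (((integrable_indicator_iff measurableSet_Icc).2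
        (integrableOn_const (by simp))).integrableOn)
    refine (hg.mul_prod integrable_inv_one_add_sq).mono' ?_ (ae_of_all _ fun p => ?_)
    · exact (Continuous.aestronglyMeasurable (by fun_prop)).mul
        hA.stronglyMeasurable_oscFT.aestronglyMeasurable
    · simp only [Function.uncurry, norm_mul, norm_exp_neg_I_quartic, one_mul]
      by_cases hp : p.1 ∈ Icc (-R) R
      · rw [indicator_of_mem hp]
        exact hC _ _
      · have : oscFT (fun x => _root_.adjointOp F (p.1, x)) p.2 = 0 := by
          rw [oscFT]
          refine integral_eq_zero_of_ae (ae_of_all _ fun x => ?_)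
          change _ * _root_.adjointOp F (p.1, x) = 0
          rw [hR p.1 x (Or.inl ?_), mul_zero]
          by_contra h
          exact hp (abs_le.1 (not_lt.1 h))
        rw [this, indicator_of_notMem hp]
        simp

lemma IsTest.exists_norm_integral_groupKernel_le {G : ℝ × ℝ → ℂ} (hG : IsTest G) :
    ∃ C : ℝ, 0 ≤ C ∧ ∀ t s : ℝ, 0 < s → ‖∫ x : ℝ, groupKernel s x * G (t, x)‖ ≤ C := by
  obtain ⟨C, hC0, hC⟩ := hG.exists_norm_oscFT_le_decay
  refine ⟨‖(1 / (2 * Real.pi) : ℂ)‖ * ∫ ξ : ℝ, C * (1 + ξ ^ 2)⁻¹, ?_, fun t s hs => ?_⟩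
  · refine mul_nonneg (norm_nonneg _) (integral_nonneg fun ξ => ?_)
    simp only [Pi.zero_apply]
    positivity
  rw [integral_groupKernel_mul hs (hG.continuous_right t) (hG.hasCompactSupport_right t)
    (hG.integrable_oscFT t), norm_mul]
  gcongr
  refine norm_integral_le_of_norm_le (integrable_inv_one_add_sq.const_mul C)
    (ae_of_all _ fun ξ => ?_)
  rw [norm_mul, norm_exp_neg_I_quartic, one_mul]
  exact hC t ξ

lemma SmoothSupp.continuous_iteratedDeriv {f : ℝ → ℂ} (hf : SmoothSupp f) (n : ℕ) :
    Continuous (iteratedDeriv n f) :=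
  hf.1.continuous_iteratedDeriv n (by exact_mod_cast le_top)

lemma SmoothSupp.iteratedDeriv_eq_zero {f : ℝ → ℂ} (hf : SmoothSupp f) (n : ℕ) {s : ℝ}
    (hs : s ≤ 0) : iteratedDeriv n f s = 0 := by
  have hc := hf.continuous_iteratedDeriv n
  have h0 : EqOn (iteratedDeriv n f) (fun _ => 0) (Iio 0) := by
    intro s hs
    have : f =ᶠ[nhds s] fun _ => (0 : ℂ) := by
      filter_upwards [Iio_mem_nhds hs] with x hx using hf.2 x hx
    rw [this.iteratedDeriv_eq]
    simp
  have := h0.closure hc continuous_const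
  rw [closure_Iio] at this
  exact this hs

lemma SmoothSupp.RL_eq {f : ℝ → ℂ} (hf : SmoothSupp f) (t : ℝ) :
    RL (-(3 : ℂ) / 4) f t = (1 / Complex.Gamma (5 / 4)) *
      ∫ s in (0 : ℝ)..t, (((max (t - s) 0) ^ ((1 : ℝ) / 4) : ℝ) : ℂ) * iteratedDeriv 2 f s := by
  have hre : (-(3 : ℂ) / 4).re = -3 / 4 := by
    rw [show (-(3 : ℂ) / 4) = ((-3 / 4 : ℝ) : ℂ) by push_cast; ring, Complex.ofReal_re]
  have hceil : ⌈-(-(3 : ℂ) / 4).re⌉₊ = 1 := by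
    rw [hre, Nat.ceil_eq_iff one_ne_zero]
    norm_num
  rw [RL, if_neg (by rw [hre]; norm_num), hceil]
  congr 1
  · congr 2
    push_cast
    ring
  · refine intervalIntegral.integral_congr fun s hs => ?_
    simp only [Nat.reduceAdd]
    rcases le_total 0 t with ht | ht
    · rw [uIcc_of_le ht] at hs
      have h : 0 ≤ t - s := sub_nonneg.2 hs.2
      rw [max_eq_left h, Complex.ofReal_cpow h]
      congr 2
      push_cast
      ring
    · rw [uIcc_of_ge ht] at hs
      rw [hf.iteratedDeriv_eq_zero 2 hs.2, mul_zero, mul_zero]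

lemma SmoothSupp.continuous_RL {f : ℝ → ℂ} (hf : SmoothSupp f) :
    Continuous (RL (-(3 : ℂ) / 4) f) := by
  rw [funext hf.RL_eq]
  have hc := hf.continuous_iteratedDeriv 2
  refine continuous_const.mul
    (intervalIntegral.continuous_parametric_intervalIntegral_of_continuous ?_ continuous_id)
  refine Continuous.mul (Complex.continuous_ofReal.comp ?_) (hc.comp continuous_snd)
  exact Continuous.rpow_const (by fun_prop) fun _ => Or.inr (by norm_num)

lemma SmoothSupp.RL_eq_zero {f : ℝ → ℂ} (hf : SmoothSupp f) {t : ℝ} (ht : t ≤ 0) :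
    RL (-(3 : ℂ) / 4) f t = 0 := by
  rw [hf.RL_eq, intervalIntegral.integral_congr (g := fun _ => (0 : ℂ)) fun s hs => ?_]
  · simp
  · rw [uIcc_of_ge ht] at hs
    simp only [hf.iteratedDeriv_eq_zero 2 hs.2, mul_zero]

lemma integral_groupKernel_eq {g : ℝ → ℂ} (hg : ∀ u ≤ 0, g u = 0) (t x : ℝ) :
    ∫ u in (0 : ℝ)..t, groupKernel (t - u) x * g u =
      ∫ u : ℝ, if u < t then groupKernel (t - u) x * g u else 0 := by
  rcases le_total 0 t with ht | ht
  · rw [intervalIntegral.integral_of_le ht, integral_Ioc_eq_integral_Ioo,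
      ← integral_indicator measurableSet_Ioo]
    refine integral_congr_ae (ae_of_all _ fun u => ?_)
    by_cases hu : 0 < u
    · simp [indicator, hu]
    · simp [indicator, hu, hg u (not_lt.1 hu)]
  · rw [intervalIntegral.integral_congr (g := fun _ => (0 : ℂ)) fun u hu => ?_]
    · rw [intervalIntegral.integral_zero, eq_comm]
      refine integral_eq_zero_of_ae (ae_of_all _ fun u => ?_)
      by_cases hu : u < t
      · simp [hg u (hu.le.trans ht)]
      · simp [hu]
    · rw [uIcc_of_ge ht] at hu
      simp [hg u hu.2]

section DuhamelPairing

variable {g : ℝ → ℂ} {A : ℝ × ℝ → ℂ}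

lemma measurable_groupKernel_mul (hA : IsTest A) : Measurable fun q : (ℝ × ℝ) × ℝ =>
    groupKernel (q.1.1 - q.1.2) q.2 * A (q.1.1, q.2) := by
  have h := measurable_groupKernel
  have hm : Measurable A := hA.continuous.measurable
  exact (h.comp (by fun_prop : Measurable fun q : (ℝ × ℝ) × ℝ => (q.1.1 - q.1.2, q.2))).mul
    (hm.comp (by fun_prop))

lemma integrableOn_sub_rpow {r : ℝ} (hr : -1 < r) (t : ℝ) :
    IntegrableOn (fun u : ℝ => (t - u) ^ r) (Ioo 0 t) := by
  have h := (intervalIntegral.intervalIntegrable_rpow' hr (a := t) (b := 0)).comp_sub_left t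
  simp only [sub_self, sub_zero] at h
  exact h.1.mono_set Ioo_subset_Ioc_self

/-- Absolute convergence of the Duhamel integral against a test function at a fixed time. -/
lemma integrable_duhamel_slice (hgc : Continuous g) (hg : ∀ u ≤ 0, g u = 0) (hA : IsTest A)
    (t : ℝ) : Integrable (Function.uncurry fun x u : ℝ =>
      (if u < t then groupKernel (t - u) x * g u else 0) * A (t, x))
      (volume.prod volume) := by
  obtain ⟨R, hR0, hR⟩ := hA.exists_support_bound
  obtain ⟨C, hC⟩ := hA.2.exists_bound_of_continuous hA.continuous
  obtain ⟨D, hD⟩ := (isCompact_Icc (a := 0) (b := t)).exists_bound_of_continuousOn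
    hgc.continuousOn
  have hC0 : 0 ≤ C := (norm_nonneg _).trans (hC 0)
  have h1 : Integrable ((Icc (-R) R).indicator fun _ : ℝ => C) :=
    (integrable_indicator_iff measurableSet_Icc).2 (integrableOn_const (by simp))
  have h2 : Integrable ((Ioo 0 t).indicator fun u : ℝ =>
      (R * (t - u) ^ (-(1 / 2) : ℝ) + 5 * (t - u) ^ (-(1 / 4) : ℝ)) * D) :=
    (integrable_indicator_iff measurableSet_Ioo).2
      ((((integrableOn_sub_rpow (by norm_num) t).const_mul R).add
        ((integrableOn_sub_rpow (by norm_num) t).const_mul 5)).mul_const D)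
  refine (h1.mul_prod h2).mono' ?_ (ae_of_all _ fun p => ?_)
  · have hk := measurable_groupKernel.comp
      (by fun_prop : Measurable fun q : ℝ × ℝ => (t - q.2, q.1))
    have hm : Measurable fun q : ℝ × ℝ => A (t, q.1) :=
      (hA.continuous_right t).measurable.comp measurable_fst
    refine (Measurable.mul (Measurable.ite ?_ (hk.mul (hgc.measurable.comp measurable_snd))
      measurable_const) hm).aestronglyMeasurable
    exact measurableSet_lt measurable_snd measurable_const
  · obtain ⟨x, u⟩ := p
    simp only [Function.uncurry]
    by_cases hx : x ∈ Icc (-R) R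
    · by_cases hu : u ∈ Ioo 0 t
      · rw [indicator_of_mem hx, indicator_of_mem hu, if_pos hu.2, norm_mul, norm_mul, mul_comm]
        have hpos : 0 < t - u := sub_pos.2 hu.2
        have hk := norm_groupKernel_le hpos x
        have hxR : |x| ≤ R := abs_le.2 hx
        have hk' : ‖groupKernel (t - u) x‖ ≤
            R * (t - u) ^ (-(1 / 2) : ℝ) + 5 * (t - u) ^ (-(1 / 4) : ℝ) := by
          refine hk.trans ?_
          gcongr
        have hDu := hD u ⟨hu.1.le, hu.2.le⟩
        exact mul_le_mul (hC _) (mul_le_mul hk' hDu (norm_nonneg _) ((norm_nonneg _).trans hk'))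
          (by positivity) hC0
      · rw [indicator_of_notMem hu, mul_zero]
        by_cases hut : u < t
        · rw [hg u (not_lt.1 fun h => hu ⟨h, hut⟩)]
          simp
        · simp [hut]
    · rw [indicator_of_notMem hx, hR t x (Or.inr (not_le.1 fun h => hx (abs_le.1 h)))]
      simp

lemma integrable_duhamel_pairing (hgc : Continuous g) (hg : ∀ u ≤ 0, g u = 0) (hA : IsTest A) :
    Integrable (Function.uncurry fun t u : ℝ => if u < t then
      g u * ∫ x : ℝ, groupKernel (t - u) x * A (t, x) else 0) (volume.prod volume) := by
  obtain ⟨R, hR0, hR⟩ := hA.exists_support_bound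
  obtain ⟨C, hC0, hC⟩ := hA.exists_norm_integral_groupKernel_le
  obtain ⟨D, hD⟩ := (isCompact_Icc (a := 0) (b := R)).exists_bound_of_continuousOn
    hgc.continuousOn
  have h1 : Integrable ((Icc (-R) R).indicator fun _ : ℝ => C) :=
    (integrable_indicator_iff measurableSet_Icc).2 (integrableOn_const (by simp))
  have h2 : Integrable ((Icc 0 R).indicator fun _ : ℝ => D) :=
    (integrable_indicator_iff measurableSet_Icc).2 (integrableOn_const (by simp))
  refine (h1.mul_prod h2).mono' ?_ (ae_of_all _ fun p => ?_)
  · have hI := (measurable_groupKernel_mul hA).stronglyMeasurable.integral_prod_right'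
      (ν := volume)
    refine (Measurable.ite (measurableSet_lt measurable_snd measurable_fst)
      ((hgc.measurable.comp measurable_snd).mul hI.measurable)
      measurable_const).aestronglyMeasurable
  · obtain ⟨t, u⟩ := p
    simp only [Function.uncurry]
    have hrhs : 0 ≤ (Icc (-R) R).indicator (fun _ : ℝ => C) t *
        (Icc 0 R).indicator (fun _ : ℝ => D) u := by
      refine mul_nonneg (indicator_nonneg (fun _ _ => hC0) _) (indicator_nonneg (fun v hv => ?_) _)
      exact (norm_nonneg _).trans (hD v hv)
    by_cases hut : u < t
    · rw [if_pos hut]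
      by_cases ht : t ∈ Icc (-R) R
      · by_cases hu : u ≤ 0
        · simpa [hg u hu] using hrhs
        · have hu' : u ∈ Icc 0 R := ⟨(not_le.1 hu).le, hut.le.trans ht.2⟩
          rw [indicator_of_mem ht, indicator_of_mem hu', norm_mul, mul_comm]
          exact mul_le_mul (hC t _ (sub_pos.2 hut)) (hD u hu') (norm_nonneg _) hC0
      · have : ∀ x, A (t, x) = 0 := fun x =>
          hR t x (Or.inl (not_le.1 fun h => ht (abs_le.1 h)))
        simpa [this] using hrhs
    · simpa [hut] using hrhs

/-- Weak form of the Duhamel formula with forcing `g(t) δ₀(x)`. -/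
lemma IsTest.integral_duhamel_adjointOp {F : ℝ × ℝ → ℂ} (hF : IsTest F) (hgc : Continuous g)
    (hg : ∀ u ≤ 0, g u = 0) :
    ∫ t : ℝ, ∫ x : ℝ, (∫ u in (0 : ℝ)..t, groupKernel (t - u) x * g u) *
      _root_.adjointOp F (t, x) = Complex.I * ∫ u : ℝ, g u * F (u, 0) := by
  have hA := hF.adjointOp
  simp_rw [integral_groupKernel_eq hg, ← integral_mul_const]
  simp_rw [fun t => integral_integral_swap (integrable_duhamel_slice hgc hg hA t)]
  have h1 : ∀ t u : ℝ, ∫ x : ℝ, (if u < t then groupKernel (t - u) x * g u else 0) *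
      _root_.adjointOp F (t, x) = if u < t then
        g u * ∫ x : ℝ, groupKernel (t - u) x * _root_.adjointOp F (t, x) else 0 := by
    intro t u
    split_ifs
    · rw [← integral_const_mul]
      refine integral_congr_ae (ae_of_all _ fun x => ?_)
      simp only
      ring
    · simp
  simp_rw [h1]
  rw [integral_integral_swap (integrable_duhamel_pairing hgc hg hA), ← integral_const_mul]
  refine integral_congr_ae (ae_of_all _ fun u => ?_)
  simp only
  rw [← mul_assoc, mul_comm Complex.I, mul_assoc, ← hF.integral_groupKernel_adjointOp u,
    ← integral_const_mul, ← integral_indicator measurableSet_Ioi]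
  refine integral_congr_ae (ae_of_all _ fun t => ?_)
  simp [indicator]

end DuhamelPairing

lemma IsTest.adjointOp_apply {φ : ℝ → ℝ → ℂ} (hφ : IsTest fun p : ℝ × ℝ => φ p.1 p.2) (t x : ℝ) :
    -Complex.I * deriv (fun t' => φ t' x) t - iteratedDeriv 4 (φ t) x =
      _root_.adjointOp (fun p : ℝ × ℝ => φ p.1 p.2) (t, x) := by
  have key : ∀ {G : ℝ × ℝ → ℂ}, IsTest G →
      deriv (fun x => G (t, x)) = fun x => _root_.partialX G (t, x) :=
    fun hG => funext fun x => (hG.hasDerivAt_right t x).deriv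
  have h0 : deriv (φ t) = fun x => _root_.partialX (fun p : ℝ × ℝ => φ p.1 p.2) (t, x) := key hφ
  rw [(hφ.hasDerivAt_left t x).deriv]
  simp only [iteratedDeriv_succ, iteratedDeriv_zero, h0, key hφ.partialX, key hφ.partialX.partialX,
    key hφ.partialX.partialX.partialX]
  rfl

/-- the distributional identity
`(i∂ₜ - ∂ₓ⁴) L⁰f(t,x) = i M δ₀(x) I_{-3/4}f(t)` on `ℝ²`, expressed by pairing against
an arbitrary test function `φ`. -/
theorem Lzero_distributional_identity (f : ℝ → ℂ) (hf : SmoothSupp f)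
    (φ : ℝ → ℝ → ℂ) (hφ : ContDiff ℝ (⊤ : ℕ∞) fun p : ℝ × ℝ => φ p.1 p.2)
    (hφc : HasCompactSupport fun p : ℝ × ℝ => φ p.1 p.2) :
    (∫ t : ℝ, ∫ x : ℝ, Lzero f t x *
        (-Complex.I * deriv (fun t' => φ t' x) t - iteratedDeriv 4 (φ t) x)) =
      Complex.I * Mconst * ∫ t : ℝ, RL (-(3 : ℂ) / 4) f t * φ t 0 := by
  have hF : IsTest fun p : ℝ × ℝ => φ p.1 p.2 := ⟨hφ, hφc⟩
  have h := hF.integral_duhamel_adjointOp hf.continuous_RL fun u hu => hf.RL_eq_zero hu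
  rw [mul_comm Complex.I, mul_assoc]
  refine Eq.trans ?_ (congrArg (Mconst * ·) h)
  rw [← integral_const_mul]
  refine integral_congr_ae (ae_of_all _ fun t => ?_)
  simp only
  rw [← integral_const_mul]
  refine integral_congr_ae (ae_of_all _ fun x => ?_)
  simp only
  rw [hF.adjointOp_apply, ← mul_assoc]
  rfl
end
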